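/- Every recursive causal model has unique solutions under every intervention: if T is a recursive causal model over a signature S, then for every vector X⃗ of distinct endogenous variables, every vector x⃗ of values for X⃗, and every setting u⃗ of the exogenous variables, the equations in T_{X⃗←x⃗}(u⃗) have exactly one solution. Hence T_rec(S) ⊆ T_uniq(S). -/

import Mathlib

/-- A signature `S = (U, V, R)`: finite (disjoint) sets of exogenous variables `U` and
endogenous variables `V`, together with a nonempty finite set (here: type) of possible
values for each variable. -/
structure Signature where
  U : Type
  V : Type
  uFin : Fintype U
  vFin : Fintype V
  vDecEq : DecidableEq V
  valU : U → Type
  valV : V → Type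
  valUFin : ∀ u, Fintype (valU u)
  valVFin : ∀ X, Fintype (valV X)
  valUNonempty : ∀ u, Nonempty (valU u)
  valVNonempty : ∀ X, Nonempty (valV X)

attribute [instance] Signature.uFin Signature.vFin Signature.vDecEq
  Signature.valUFin Signature.valVFin Signature.valUNonempty Signature.valVNonempty

/-- The standing assumption `|R(Y)| ≥ 2` for every variable `Y`. -/
def Signature.Standard (S : Signature) : Prop :=
  (∀ u, 2 ≤ Fintype.card (S.valU u)) ∧ (∀ X, 2 ≤ Fintype.card (S.valV X))

/-- A setting `u⃗` of values for all the exogenous variables. -/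
abbrev Signature.Context (S : Signature) : Type := ∀ u : S.U, S.valU u

/-- An assignment of values to all the endogenous variables. -/
abbrev Signature.Assignment (S : Signature) : Type := ∀ X : S.V, S.valV X

/-- An intervention `X⃗ ← x⃗`: a vector of distinct endogenous variables together with
values for them, encoded as a partial assignment. -/
abbrev Signature.Intervention (S : Signature) : Type := ∀ X : S.V, Option (S.valV X)

/-- The empty intervention (`[true]`). -/
def Signature.emptyInt (S : Signature) : S.Intervention := fun _ => none

/-- Extend an intervention by additionally setting `W` to `w`. -/
def intUpdate {S : Signature} (g : S.Intervention) (W : S.V) (w : S.valV W) :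
    S.Intervention :=
  fun X => if h : X = W then some (cast (congrArg S.valV h).symm w) else g X

/-- A causal model `T = (S, F)` over the signature `S`. -/
structure CausalModel (S : Signature) where
  F : ∀ X : S.V, S.Context → (∀ Y : S.V, Y ≠ X → S.valV Y) → S.valV X

/-- `v` is a solution of `T_{X⃗ ← x⃗}(u⃗)` (intervention encoded by `g`): intervened
variables take their set values, and every other variable satisfies its equation. -/
def CausalModel.IsSolution {S : Signature} (T : CausalModel S) (g : S.Intervention)
    (u : S.Context) (v : S.Assignment) : Prop :=
  ∀ X : S.V,
    (∀ x, g X = some x → v X = x) ∧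
    (g X = none → v X = T.F X u fun Y _ => v Y)

/-- `T ∈ T_uniq(S)`: the equations of `T_{X⃗ ← x⃗}(u⃗)` have a unique solution, for every
intervention and every context. -/
def CausalModel.UniqueSolutions {S : Signature} (T : CausalModel S) : Prop :=
  ∀ (g : S.Intervention) (u : S.Context), ∃! v : S.Assignment, T.IsSolution g u v

/-- `T ∈ T_rec(S)`: there is a (strict) total order `≺` on `V` such that `F_X` is
independent of the value of `Y` whenever `X ≺ Y`. -/
def CausalModel.Recursive {S : Signature} (T : CausalModel S) : Prop :=
  ∃ r : S.V → S.V → Prop, IsStrictTotalOrder S.V r ∧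
    ∀ (X : S.V) (u : S.Context) (w w' : ∀ Y : S.V, Y ≠ X → S.valV Y),
      (∀ (Y : S.V) (h : Y ≠ X), ¬ r X Y → w Y h = w' Y h) →
      T.F X u w = T.F X u w'

/-- Boolean combinations of atoms of the form `X(u⃗) = x`. -/
inductive IForm (S : Signature) : Type where
  | atom : (X : S.V) → S.Context → S.valV X → IForm S
  | not : IForm S → IForm S
  | and : IForm S → IForm S → IForm S
  | or : IForm S → IForm S → IForm S

namespace IForm

variable {S : Signature}

/-- The settings `u⃗` of the exogenous variables mentioned in a formula. -/
def mentions : IForm S → Set S.Context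
  | atom _ u _ => {u}
  | not φ => φ.mentions
  | and φ ψ => φ.mentions ∪ ψ.mentions
  | or φ ψ => φ.mentions ∪ ψ.mentions

/-- The endogenous variables appearing in a formula. -/
def vars : IForm S → Set S.V
  | atom X _ _ => {X}
  | not φ => φ.vars
  | and φ ψ => φ.vars ∪ ψ.vars
  | or φ ψ => φ.vars ∪ ψ.vars

/-- Evaluate a Boolean combination of atoms, where the atoms mentioning `u⃗` are
evaluated in the assignment `σ u⃗`. -/
def eval (σ : S.Context → S.Assignment) : IForm S → Prop
  | atom X u x => σ u X = x
  | not φ => ¬ φ.eval σ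
  | and φ ψ => φ.eval σ ∧ ψ.eval σ
  | or φ ψ => φ.eval σ ∨ ψ.eval σ

def imp (φ ψ : IForm S) : IForm S := or (not φ) ψ

/-- `φ ∧ ψ₁ ∧ … ∧ ψₙ`. -/
def conj (φ : IForm S) : List (IForm S) → IForm S
  | [] => φ
  | ψ :: l => and φ (conj ψ l)

/-- `φ ∨ ψ₁ ∨ … ∨ ψₙ`. -/
def disj (φ : IForm S) : List (IForm S) → IForm S
  | [] => φ
  | ψ :: l => or φ (disj ψ l)

/-- Evaluation under an arbitrary truth assignment to the atoms. -/
def pEval (val : ∀ X : S.V, S.Context → S.valV X → Prop) : IForm S → Prop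
  | atom X u x => val X u x
  | not φ => ¬ φ.pEval val
  | and φ ψ => φ.pEval val ∧ ψ.pEval val
  | or φ ψ => φ.pEval val ∨ ψ.pEval val

/-- An instance of a propositional tautology. -/
def Tautology (φ : IForm S) : Prop := ∀ val, φ.pEval val

theorem mentions_nonempty : ∀ φ : IForm S, φ.mentions.Nonempty
  | atom _ u _ => ⟨u, rfl⟩
  | not φ => mentions_nonempty φ
  | and φ _ => (mentions_nonempty φ).imp fun _ h => Set.mem_union_left _ h
  | or φ _ => (mentions_nonempty φ).imp fun _ h => Set.mem_union_left _ h

end IForm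

/-- `T ⊨ [X⃗ ← x⃗] φ` : for every choice, for each mentioned setting `u⃗`, of a solution
of `T_{X⃗ ← x⃗}(u⃗)`, the formula `φ` evaluates to true. -/
def CausalModel.boxSat {S : Signature} (T : CausalModel S) (g : S.Intervention)
    (φ : IForm S) : Prop :=
  ∀ σ : S.Context → S.Assignment,
    (∀ u ∈ φ.mentions, T.IsSolution g u (σ u)) → φ.eval σ

/-- The language `L⁺(S)`: Boolean combinations of basic causal formulas `[Y⃗ ← y⃗] φ`. -/
inductive LPlus (S : Signature) : Type where
  | box : S.Intervention → IForm S → LPlus S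
  | not : LPlus S → LPlus S
  | and : LPlus S → LPlus S → LPlus S
  | or : LPlus S → LPlus S → LPlus S

namespace LPlus

variable {S : Signature}

/-- Truth of a causal formula in a causal model. -/
def sat : LPlus S → CausalModel S → Prop
  | box g φ, T => T.boxSat g φ
  | not φ, T => ¬ φ.sat T
  | and φ ψ, T => φ.sat T ∧ ψ.sat T
  | or φ ψ, T => φ.sat T ∨ ψ.sat T

/-- `⟨X⃗ ← x⃗⟩ φ` abbreviates `¬ [X⃗ ← x⃗] ¬ φ`. -/
def dia (g : S.Intervention) (φ : IForm S) : LPlus S := not (box g (IForm.not φ))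

def imp (φ ψ : LPlus S) : LPlus S := or (not φ) ψ

def iff (φ ψ : LPlus S) : LPlus S := and (imp φ ψ) (imp ψ φ)

def conj (φ : LPlus S) : List (LPlus S) → LPlus S
  | [] => φ
  | ψ :: l => and φ (conj ψ l)

def disj (φ : LPlus S) : List (LPlus S) → LPlus S
  | [] => φ
  | ψ :: l => or φ (disj ψ l)

/-- Membership in the sublanguage `L_uniq(S)`: Boolean combinations of formulas of the
form `[Y⃗ ← y⃗](X(u⃗) = x)`. -/
def InLuniq : LPlus S → Prop
  | box _ φ => ∃ (X : S.V) (u : S.Context) (x : S.valV X), φ = IForm.atom X u x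
  | not φ => φ.InLuniq
  | and φ ψ => φ.InLuniq ∧ ψ.InLuniq
  | or φ ψ => φ.InLuniq ∧ ψ.InLuniq

/-- Evaluation under an arbitrary truth assignment to the basic causal formulas. -/
def pEval (val : S.Intervention → IForm S → Prop) : LPlus S → Prop
  | box g φ => val g φ
  | not φ => ¬ φ.pEval val
  | and φ ψ => φ.pEval val ∧ ψ.pEval val
  | or φ ψ => φ.pEval val ∨ ψ.pEval val

/-- An instance of a propositional tautology. -/
def Tautology (φ : LPlus S) : Prop := ∀ val, φ.pEval val

/-- The endogenous variables appearing in a causal formula (including the variables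
set by its interventions). -/
def vars : LPlus S → Set S.V
  | box g φ => {X | g X ≠ none} ∪ φ.vars
  | not φ => φ.vars
  | and φ ψ => φ.vars ∪ ψ.vars
  | or φ ψ => φ.vars ∪ ψ.vars

/-- The settings of the exogenous variables mentioned in a causal formula. -/
def contexts : LPlus S → Set S.Context
  | box _ φ => φ.mentions
  | not φ => φ.contexts
  | and φ ψ => φ.contexts ∪ ψ.contexts
  | or φ ψ => φ.contexts ∪ ψ.contexts

theorem contexts_nonempty : ∀ φ : LPlus S, φ.contexts.Nonempty
  | box _ φ => φ.mentions_nonempty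
  | not φ => contexts_nonempty φ
  | and φ _ => (contexts_nonempty φ).imp fun _ h => Set.mem_union_left _ h
  | or φ _ => (contexts_nonempty φ).imp fun _ h => Set.mem_union_left _ h

end LPlus

/-- `Y` affects `Z` in `T`: for some setting of the exogenous variables and of some
other endogenous variables, changing the value of `Y` changes the value of `Z`. -/
def CausalModel.Affects {S : Signature} (T : CausalModel S) (Y Z : S.V) : Prop :=
  Y ≠ Z ∧ ∃ (g : S.Intervention) (y : S.valV Y) (u : S.Context) (z z' : S.valV Z),
    g Y = none ∧ g Z = none ∧ z ≠ z' ∧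
    T.boxSat (intUpdate g Y y) (IForm.atom Z u z') ∧ T.boxSat g (IForm.atom Z u z)

/-- Provability from a set of axioms using modus ponens. -/
inductive Provable {S : Signature} (Ax : Set (LPlus S)) : LPlus S → Prop
  | ax : ∀ {φ}, φ ∈ Ax → Provable Ax φ
  | mp : ∀ {φ ψ}, Provable Ax (φ.imp ψ) → Provable Ax φ → Provable Ax ψ

/-- A system of equations along a well-founded relation, in which each equation depends
only on the values at smaller indices, has exactly one solution. -/
theorem WellFounded.existsUnique_forall_eq {ι : Type*} {α : ι → Type*} [∀ i, Nonempty (α i)]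
    {r : ι → ι → Prop} (hr : WellFounded r) (G : ∀ i, (∀ j, α j) → α i)
    (hG : ∀ i v w, (∀ j, r j i → v j = w j) → G i v = G i w) :
    ∃! v : ∀ i, α i, ∀ i, v i = G i v := by
  classical
  let step : ∀ i, (∀ j, r j i → α j) → α i := fun i f =>
    G i fun j => if h : r j i then f j h else Classical.arbitrary (α j)
  refine ⟨hr.fix step, fun i => ?_, fun w hw => funext fun i => ?_⟩
  · rw [hr.fix_eq]
    exact hG i _ _ fun j hj => dif_pos hj
  · induction i using hr.induction with
    | _ i ih =>
      rw [hw i, hr.fix_eq]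
      exact hG i _ _ fun j hj => by rw [ih j hj, dif_pos hj]

/-- Solutions are the fixed points of the equations in which every intervened variable is
replaced by the constant it is set to. -/
theorem CausalModel.isSolution_iff {S : Signature} (T : CausalModel S) (g : S.Intervention)
    (u : S.Context) (v : S.Assignment) :
    T.IsSolution g u v ↔ ∀ X, v X = (g X).getD (T.F X u fun Y _ => v Y) := by
  refine forall_congr' fun X => ?_
  cases g X <;> simp

/-- every recursive causal model has unique solutions under every
intervention; hence `T_rec(S) ⊆ T_uniq(S)`. -/
theorem recursive_implies_uniqueSolutions (S : Signature) (hS : S.Standard)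
    (T : CausalModel S) (hT : T.Recursive) : T.UniqueSolutions := by
  obtain ⟨r, hr, hF⟩ := hT
  intro g u
  simp only [T.isSolution_iff]
  have hwf : WellFounded r := Finite.wellFounded_of_trans_of_irrefl r
  refine hwf.existsUnique_forall_eq (fun X v => (g X).getD (T.F X u fun Y _ => v Y))
    fun X v w h => congrArg (g X).getD (hF X u _ _ fun Y hne hXY => h Y ?_)
  exact (trichotomous_of r Y X).resolve_right (not_or.2 ⟨hne, hXY⟩)
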